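/- For every positive root β ∈ Φ⁺, the number of rank two subsystems R that cut β^⊥ is at most (ℓ(t_β) − 1)/2; in particular, only finitely many rank two subsystems cut β^⊥. -/

import Mathlib

/-!
Setup: a symmetrizable crystallographic Cartan matrix `A` with symmetrizers `d`,
the vector space `V = Fin n → ℝ` with standard basis `α i = Pi.single i 1`,
the bilinear form `(α i, α j) = d i * A i j`, the simple reflections
`s i (x) = x - (dᵢ⁻¹ αᵢ, x) αᵢ`, the group `W` generated by them (elements of
which are represented as products of lists of simple reflections), and the
set of real roots `Φ = { w (α i) }`.
-/

open Finset

noncomputable section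

/-- The simple root `α i`, i.e. the `i`-th standard basis vector of `ℝⁿ`. -/
def sroot (n : ℕ) (i : Fin n) : Fin n → ℝ := Pi.single i 1

/-- The symmetric bilinear form with `(α i, α j) = d i * A i j`. -/
def formL (n : ℕ) (d : Fin n → ℤ) (A : Fin n → Fin n → ℤ) :
    (Fin n → ℝ) →ₗ[ℝ] (Fin n → ℝ) →ₗ[ℝ] ℝ :=
  ∑ i : Fin n, ∑ j : Fin n,
    ((d i * A i j : ℤ) : ℝ) •
      LinearMap.smulRight (LinearMap.proj i : (Fin n → ℝ) →ₗ[ℝ] ℝ)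
        (LinearMap.proj j : (Fin n → ℝ) →ₗ[ℝ] ℝ)

/-- The simple reflection `s i`, given by `s i x = x - (dᵢ⁻¹ • αᵢ, x) • αᵢ`. -/
def simpleRefl (n : ℕ) (d : Fin n → ℤ) (A : Fin n → Fin n → ℤ) (i : Fin n) :
    Module.End ℝ (Fin n → ℝ) :=
  LinearMap.id - ((d i : ℝ)⁻¹) • (formL n d A (sroot n i)).smulRight (sroot n i)

/-- The element `s i_r * ⋯ * s i_1` of `W` corresponding to the list `l = [i_1, …, i_r]`
(the reflection `s i_1` is applied first). -/
def wprod (n : ℕ) (d : Fin n → ℤ) (A : Fin n → Fin n → ℤ) (l : List (Fin n)) :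
    Module.End ℝ (Fin n → ℝ) :=
  ((l.map (simpleRefl n d A)).reverse).prod

/-- `β` is a real root: `β = w (α i)` for some `w ∈ W` and some `i`. -/
def IsRoot (n : ℕ) (d : Fin n → ℤ) (A : Fin n → Fin n → ℤ) (β : Fin n → ℝ) : Prop :=
  ∃ (l : List (Fin n)) (i : Fin n), β = wprod n d A l (sroot n i)

/-- `β` is a positive root: a real root all of whose coordinates are `≥ 0`. -/
def IsPosRoot (n : ℕ) (d : Fin n → ℤ) (A : Fin n → Fin n → ℤ) (β : Fin n → ℝ) : Prop :=
  IsRoot n d A β ∧ ∀ k, 0 ≤ β k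

/-- `β` is a negative root: a real root all of whose coordinates are `≤ 0`. -/
def IsNegRoot (n : ℕ) (d : Fin n → ℤ) (A : Fin n → Fin n → ℤ) (β : Fin n → ℝ) : Prop :=
  IsRoot n d A β ∧ ∀ k, β k ≤ 0

/-- The reflection `t_β` along a root `β`: `t_β x = x - (β^∨, x) • β` where
`β^∨ = d_β⁻¹ • β` and `d_β = (β, β)/2`. -/
def reflAlong (n : ℕ) (d : Fin n → ℤ) (A : Fin n → Fin n → ℤ) (β : Fin n → ℝ) :
    Module.End ℝ (Fin n → ℝ) :=
  LinearMap.id - (2 / formL n d A β β) • (formL n d A β).smulRight β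

/-- `s i_r ⋯ s i_1 (α j)` (encoded by the list `l = [i_1, …, i_r]` and the index `j`)
is a positive expression: each partial application moves up in the root poset, i.e.
`s i_k ⋯ s i_1 (α j) - s i_{k-1} ⋯ s i_1 (α j) ∈ ℝ_{>0} • α i_k` for all `k`. -/
def IsPosExpr (n : ℕ) (d : Fin n → ℤ) (A : Fin n → Fin n → ℤ) (j : Fin n)
    (l : List (Fin n)) : Prop :=
  ∀ k : Fin l.length, ∃ c : ℝ, 0 < c ∧
    wprod n d A (l.take (k.1 + 1)) (sroot n j) - wprod n d A (l.take k.1) (sroot n j)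
      = c • sroot n (l.get k)

/-- The length `ℓ(w)`: the smallest `r` such that `w` is a product of `r` simple
reflections. -/
def len (n : ℕ) (d : Fin n → ℤ) (A : Fin n → Fin n → ℤ)
    (w : Module.End ℝ (Fin n → ℝ)) : ℕ :=
  sInf {r | ∃ l : List (Fin n), l.length = r ∧ wprod n d A l = w}

/-- `R` is a rank two subsystem: `R = Φ ∩ L` for a two-dimensional subspace `L`
which is spanned by `R`. -/
def IsRankTwo (n : ℕ) (d : Fin n → ℤ) (A : Fin n → Fin n → ℤ)
    (R : Set (Fin n → ℝ)) : Prop :=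
  ∃ L : Submodule ℝ (Fin n → ℝ), Module.finrank ℝ L = 2 ∧
    R = {γ | IsRoot n d A γ} ∩ (L : Set (Fin n → ℝ)) ∧ Submodule.span ℝ R = L

/-- `β` is a fundamental root of `R`: it is a positive root of `R` and there is a
second positive root `β'` of `R` such that every positive root of `R` is a
nonnegative combination of `β` and `β'`. -/
def IsFundamentalIn (n : ℕ) (d : Fin n → ℤ) (A : Fin n → Fin n → ℤ)
    (R : Set (Fin n → ℝ)) (β : Fin n → ℝ) : Prop :=
  β ∈ R ∧ IsPosRoot n d A β ∧
    ∃ β' ∈ R, IsPosRoot n d A β' ∧ β' ≠ β ∧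
      ∀ γ ∈ R, IsPosRoot n d A γ →
        ∃ c c' : ℝ, 0 ≤ c ∧ 0 ≤ c' ∧ γ = c • β + c' • β'

/-- The rank two subsystem `R` cuts `β^⊥`: `β ∈ R` but `β` is not a fundamental
root of `R`. -/
def CutsPerp (n : ℕ) (d : Fin n → ℤ) (A : Fin n → Fin n → ℤ)
    (R : Set (Fin n → ℝ)) (β : Fin n → ℝ) : Prop :=
  IsRankTwo n d A R ∧ β ∈ R ∧ ¬ IsFundamentalIn n d A R β

/-- The hypotheses on the Cartan matrix. -/
structure Cart (n : ℕ) (d : Fin n → ℤ) (A : Fin n → Fin n → ℤ) : Prop where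
  hd : ∀ i, 0 < d i
  hdiag : ∀ i, A i i = 2
  hoff : ∀ i j, i ≠ j → A i j ≤ 0
  hsym : ∀ i j, d i * A i j = d j * A j i

section aux

variable {n : ℕ} {d : Fin n → ℤ} {A : Fin n → Fin n → ℤ}

/-- coordinate functional -/
def phi (n : ℕ) (d : Fin n → ℤ) (A : Fin n → Fin n → ℤ) (i : Fin n) :
    (Fin n → ℝ) →ₗ[ℝ] ℝ := ((d i : ℝ)⁻¹) • formL n d A (sroot n i)

lemma formL_apply (x y : Fin n → ℝ) :
    formL n d A x y = ∑ i, ∑ j, ((d i * A i j : ℤ) : ℝ) * (x i * y j) := by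
  simp [formL, LinearMap.sum_apply]

lemma formL_sroot (i j : Fin n) :
    formL n d A (sroot n i) (sroot n j) = (d i : ℝ) * A i j := by
  rw [formL_apply, Finset.sum_eq_single i, Finset.sum_eq_single j]
  · simp [sroot]
  · intro b _ hb; simp [sroot, hb]
  · simp
  · intro b _ hb; simp [sroot, hb]
  · simp

lemma formL_symm (h : Cart n d A) (x y : Fin n → ℝ) :
    formL n d A x y = formL n d A y x := by
  rw [formL_apply, formL_apply, Finset.sum_comm]
  refine Finset.sum_congr rfl fun i _ => Finset.sum_congr rfl fun j _ => ?_
  rw [h.hsym j i]; ring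

lemma d_ne (h : Cart n d A) (i : Fin n) : (d i : ℝ) ≠ 0 := by
  have := h.hd i
  exact_mod_cast this.ne'

lemma phi_sroot (h : Cart n d A) (i j : Fin n) :
    phi n d A i (sroot n j) = A i j := by
  have := d_ne h i
  simp only [phi, LinearMap.smul_apply, formL_sroot, smul_eq_mul]
  field_simp

lemma simple_apply (i : Fin n) (x : Fin n → ℝ) :
    simpleRefl n d A i x = x - phi n d A i x • sroot n i := by
  simp [simpleRefl, phi, mul_smul]

lemma simple_self (h : Cart n d A) (i : Fin n) :
    simpleRefl n d A i (sroot n i) = - sroot n i := by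
  rw [simple_apply, phi_sroot h, h.hdiag]
  push_cast
  module

lemma simple_sq (h : Cart n d A) (i : Fin n) :
    simpleRefl n d A i * simpleRefl n d A i = 1 := by
  refine LinearMap.ext fun x => ?_
  rw [Module.End.mul_apply]
  rw [simple_apply i x, map_sub, map_smul, simple_self h, simple_apply]
  simp

lemma form_simple (h : Cart n d A) (i : Fin n) (x y : Fin n → ℝ) :
    formL n d A (simpleRefl n d A i x) (simpleRefl n d A i y) = formL n d A x y := by
  have hd := d_ne h i
  have e1 : formL n d A (sroot n i) y = d i * phi n d A i y := by
    simp [phi]; field_simp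
  have e2 : formL n d A x (sroot n i) = d i * phi n d A i x := by
    rw [formL_symm h]; simp [phi]; field_simp
  rw [simple_apply, simple_apply]
  simp only [map_sub, map_smul, LinearMap.sub_apply, LinearMap.smul_apply, smul_eq_mul, e1, e2,
    formL_sroot, h.hdiag]
  push_cast
  ring

lemma wprod_nil : wprod n d A [] = 1 := rfl

lemma wprod_cons (i : Fin n) (l : List (Fin n)) :
    wprod n d A (i :: l) = wprod n d A l * simpleRefl n d A i := by
  simp [wprod]

lemma wprod_append (l m : List (Fin n)) :
    wprod n d A (l ++ m) = wprod n d A m * wprod n d A l := by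
  simp [wprod]

lemma wprod_rev (h : Cart n d A) (l : List (Fin n)) :
    wprod n d A l * wprod n d A l.reverse = 1 := by
  induction l with
  | nil => simp [wprod_nil]
  | cons a l ih =>
    rw [List.reverse_cons, wprod_append, wprod_cons, wprod_cons, wprod_nil, one_mul, mul_assoc,
      ← mul_assoc (simpleRefl n d A a), simple_sq h, one_mul, ih]

lemma wprod_rev' (h : Cart n d A) (l : List (Fin n)) :
    wprod n d A l.reverse * wprod n d A l = 1 := by
  simpa using wprod_rev h l.reverse

lemma form_wprod (h : Cart n d A) (l : List (Fin n)) (x y : Fin n → ℝ) :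
    formL n d A (wprod n d A l x) (wprod n d A l y) = formL n d A x y := by
  induction l generalizing x y with
  | nil => simp [wprod_nil]
  | cons a l ih => rw [wprod_cons, Module.End.mul_apply, Module.End.mul_apply, ih, form_simple h]

/-- alternating words -/
def altw {α : Type*} : α → α → ℕ → List α
  | _, _, 0 => []
  | a, b, (k+1) => a :: altw b a k

lemma altw_length {α : Type*} (a b : α) (k : ℕ) : (altw a b k).length = k := by
  induction k generalizing a b with
  | zero => rfl
  | succ k ih => simp [altw, ih]

lemma altw_add {α : Type*} (a b : α) (M k : ℕ) : ∃ r : List α, r.length = k ∧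
    altw a b (M + k) = altw a b M ++ r := by
  induction M generalizing a b with
  | zero => exact ⟨altw a b k, altw_length _ _ _, by simp [altw]⟩
  | succ M ih =>
    obtain ⟨r, hr, h⟩ := ih b a
    refine ⟨r, hr, ?_⟩
    rw [Nat.add_right_comm]
    simp [altw, h]

lemma eq_altw {α : Type*} (a b : α) (r : List α) (hr : ∀ x ∈ r, x = a ∨ x = b)
    (hc : ∀ p x q, r ≠ p ++ x :: x :: q) (hh : ∀ q, r ≠ b :: q) : r = altw a b r.length := by
  induction r generalizing a b with
  | nil => rfl
  | cons c r ih =>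
    have hc1 : c = a := by
      rcases hr c (by simp) with h | h
      · exact h
      · exact absurd (by rw [h]) (hh r)
    subst hc1
    have := ih b c (fun x hx => (hr x (by simp [hx])).symm)
      (fun p x q hpq => hc (c :: p) x q (by simp [hpq]))
      (fun q hq => hc [] c q (by simp [hq]))
    simp only [List.length_cons, altw]
    rw [← this]

lemma act_i (h : Cart n d A) (i j : Fin n) (p q : ℝ) :
    simpleRefl n d A i (p • sroot n i + q • sroot n j) =
      (-p - A i j * q) • sroot n i + q • sroot n j := by
  rw [simple_apply, map_add, map_smul, map_smul, phi_sroot h, phi_sroot h, h.hdiag]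
  push_cast
  simp only [smul_eq_mul]
  module

lemma act_j (h : Cart n d A) (i j : Fin n) (p q : ℝ) :
    simpleRefl n d A j (p • sroot n i + q • sroot n j) =
      p • sroot n i + (-q - A j i * p) • sroot n j := by
  rw [add_comm, act_i h, add_comm]

/-- nonnegative combination of two simple roots -/
def NN (n : ℕ) (i j : Fin n) (x : Fin n → ℝ) : Prop :=
  ∃ p q : ℝ, 0 ≤ p ∧ 0 ≤ q ∧ x = p • sroot n i + q • sroot n j

lemma NN_symm {i j : Fin n} {x : Fin n → ℝ} (h : NN n i j x) : NN n j i x := by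
  obtain ⟨p, q, hp, hq, rfl⟩ := h
  exact ⟨q, p, hq, hp, add_comm _ _⟩

lemma dihedral_inf (h : Cart n d A) (k : ℕ) : ∀ (i j : Fin n) (_ : i ≠ j)
    (_ : 4 ≤ A i j * A j i) (p q : ℝ), 0 ≤ p → 0 ≤ q → 2 * q ≤ - A j i * p →
    NN n i j (wprod n d A (altw j i k) (p • sroot n i + q • sroot n j)) := by
  induction k with
  | zero => intro i j _ _ p q hp hq _; exact ⟨p, q, hp, hq, by simp [altw, wprod_nil]⟩
  | succ k ih =>
    intro i j hij hab p q hp hq hpq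
    rw [altw, wprod_cons, Module.End.mul_apply, act_j h, add_comm]
    refine NN_symm (ih j i hij.symm (by linarith) _ _ (by linarith) hp ?_)
    have h1 : (4 : ℝ) ≤ A i j * A j i := by exact_mod_cast hab
    have h2 : (A i j : ℝ) ≤ 0 := by exact_mod_cast h.hoff i j hij
    nlinarith [mul_nonneg (sub_nonneg.2 hpq) (neg_nonneg.2 h2)]

lemma act_gen (h : Cart n d A) (i j : Fin n) (x : Fin n → ℝ) (p q : ℝ) :
    simpleRefl n d A i (x - p • sroot n i - q • sroot n j) =
      x - (phi n d A i x - p - A i j * q) • sroot n i - q • sroot n j := by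
  rw [simple_apply, map_sub, map_sub, map_smul, map_smul, phi_sroot h, phi_sroot h, h.hdiag]
  push_cast
  simp only [smul_eq_mul]
  module

lemma act_gen' (h : Cart n d A) (i j : Fin n) (x : Fin n → ℝ) (p q : ℝ) :
    simpleRefl n d A j (x - p • sroot n i - q • sroot n j) =
      x - p • sroot n i - (phi n d A j x - q - A j i * p) • sroot n j := by
  rw [sub_right_comm, act_gen h, sub_right_comm]

lemma wprod_cons_apply (i : Fin n) (l : List (Fin n)) (x : Fin n → ℝ) :
    wprod n d A (i :: l) x = wprod n d A l (simpleRefl n d A i x) := by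
  rw [wprod_cons]; rfl

/-- the Coxeter exponent together with braid relation and positivity below it -/
lemma dihedral_fin (h : Cart n d A) (i j : Fin n) (hij : i ≠ j) (hab : A i j * A j i < 4) :
    ∃ M, 0 < M ∧ wprod n d A (altw j i M) = wprod n d A (altw i j M) ∧
      ∀ k < M, NN n i j (wprod n d A (altw j i k) (sroot n i)) := by
  obtain ⟨a, ha⟩ : ∃ a, a = A i j := ⟨_, rfl⟩
  obtain ⟨b, hb⟩ : ∃ b, b = A j i := ⟨_, rfl⟩
  have ha0 : a ≤ 0 := ha ▸ h.hoff i j hij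
  have hb0 : b ≤ 0 := hb ▸ h.hoff j i hij.symm
  have hs : d i * a = d j * b := by rw [ha, hb]; exact h.hsym i j
  have hdi := h.hd i
  have hdj := h.hd j
  have hz : a = 0 ↔ b = 0 := by
    constructor
    · intro e; rw [e, mul_zero] at hs
      rcases mul_eq_zero.1 hs.symm with h | h <;> omega
    · intro e; rw [e, mul_zero] at hs
      rcases mul_eq_zero.1 hs with h | h <;> omega
  rw [← ha, ← hb] at hab
  have key : (a = 0 ∧ b = 0) ∨ (a = -1 ∧ b = -1) ∨ (a = -1 ∧ b = -2) ∨ (a = -2 ∧ b = -1) ∨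
      (a = -1 ∧ b = -3) ∨ (a = -3 ∧ b = -1) := by
    by_cases a0 : a = 0
    · left; exact ⟨a0, hz.1 a0⟩
    · have b0 : b ≠ 0 := fun e => a0 (hz.2 e)
      have a1 : a ≤ -1 := by omega
      have b1 : b ≤ -1 := by omega
      have a2 : -4 < a := by nlinarith
      have b2 : -4 < b := by nlinarith
      interval_cases a <;> interval_cases b <;> omega
  have start : ∀ x : Fin n → ℝ, x = x - (0:ℝ) • sroot n i - (0:ℝ) • sroot n j := by
    intro x; module
  have start' : sroot n i = (1:ℝ) • sroot n i + (0:ℝ) • sroot n j := by module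
  rcases key with ⟨e1, e2⟩ | ⟨e1, e2⟩ | ⟨e1, e2⟩ | ⟨e1, e2⟩ | ⟨e1, e2⟩ | ⟨e1, e2⟩
  case' inl => refine ⟨2, by norm_num, ?_, ?_⟩
  case' inr.inl => refine ⟨3, by norm_num, ?_, ?_⟩
  case' inr.inr.inl => refine ⟨4, by norm_num, ?_, ?_⟩
  case' inr.inr.inr.inl => refine ⟨4, by norm_num, ?_, ?_⟩
  case' inr.inr.inr.inr.inl => refine ⟨6, by norm_num, ?_, ?_⟩
  case' inr.inr.inr.inr.inr => refine ⟨6, by norm_num, ?_, ?_⟩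
  all_goals first
    | (refine LinearMap.ext fun x => ?_
       conv_lhs => rw [start x]
       conv_rhs => rw [start x]
       simp only [altw, wprod_cons_apply, wprod_nil, Module.End.one_apply, act_gen h i j,
         act_gen' h i j, ← ha, ← hb, e1, e2]
       push_cast
       congr 2
       · ring_nf
       · ring_nf)
    | (intro k hk
       rw [start']
       interval_cases k <;>
       simp only [altw, wprod_cons_apply, wprod_nil, Module.End.one_apply, act_i h i j,
         act_j h i j, ← ha, ← hb, e1, e2] <;>
       refine ⟨_, _, ?_, ?_, rfl⟩ <;> push_cast <;> norm_num)

lemma dihedral (h : Cart n d A) (i j : Fin n) (hij : i ≠ j) (m : List (Fin n))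
    (hm : ∀ x ∈ m, x = j ∨ x = i)
    (h1 : ∀ m', wprod n d A m' = wprod n d A m → m.length ≤ m'.length)
    (h2 : ∀ m', wprod n d A m' = wprod n d A (i :: m) → m.length ≤ m'.length) :
    NN n i j (wprod n d A m (sroot n i)) := by
  have halt : m = altw j i m.length := by
    apply eq_altw _ _ _ hm
    · intro p x q e
      have := h1 (p ++ q) (by
        rw [e, wprod_append, wprod_append, wprod_cons, wprod_cons, mul_assoc (wprod n d A q),
          simple_sq h, mul_one])
      rw [e] at this
      simp at this
    · intro q e
      have := h2 q (by
        rw [e, wprod_cons, wprod_cons, mul_assoc _ (simpleRefl n d A i), simple_sq h, mul_one])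
      rw [e] at this
      simp at this
  by_cases hab : A i j * A j i < 4
  · obtain ⟨M, hM, hbr, hpos⟩ := dihedral_fin h i j hij hab
    by_cases hk : m.length < M
    · rw [halt]; exact hpos _ hk
    · exfalso
      obtain ⟨k, hk'⟩ := Nat.exists_eq_add_of_le (not_lt.1 hk)
      obtain ⟨r, hr, hr'⟩ := altw_add j i M k
      rw [← hk', ← halt] at hr'
      obtain ⟨M', rfl⟩ : ∃ M', M = M' + 1 := ⟨M - 1, by omega⟩
      have := h2 (altw j i M' ++ r) (by
        rw [wprod_cons, hr', wprod_append, wprod_append, hbr, altw, wprod_cons]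
        rw [mul_assoc, mul_assoc, simple_sq h, mul_one])
      simp [altw_length, hr] at this
      omega
  · rw [halt]
    have := dihedral_inf h m.length i j hij (not_lt.1 hab) 1 0 (by norm_num) le_rfl (by
      have : (A j i : ℝ) ≤ 0 := by exact_mod_cast h.hoff j i hij.symm
      linarith)
    simpa using this

lemma pos_main (h : Cart n d A) (N : ℕ) : ∀ (l : List (Fin n)), l.length = N →
    (∀ l', wprod n d A l' = wprod n d A l → N ≤ l'.length) → ∀ i,
    (∀ l', wprod n d A l' = wprod n d A (i :: l) → N ≤ l'.length) →
    0 ≤ wprod n d A l (sroot n i) := by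
  induction N using Nat.strong_induction_on with
  | _ N ih =>
  intro l hl hred i hi
  cases l with
  | nil =>
    simp only [wprod_nil, Module.End.one_apply, sroot]
    exact Pi.single_nonneg.2 zero_le_one
  | cons j l0 =>
    have hij : i ≠ j := by
      rintro rfl
      have := hi l0 (by
        rw [wprod_cons, wprod_cons, mul_assoc, simple_sq h, mul_one])
      simp at hl
      omega
    have hex : ∃ k, ∃ v m : List (Fin n), v.length = k ∧ (∀ x ∈ m, x = j ∨ x = i) ∧
        m.length + v.length = N ∧ wprod n d A (m ++ v) = wprod n d A (j :: l0) :=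
      ⟨l0.length, l0, [j], rfl, by simp, by simp at hl ⊢; omega, rfl⟩
    classical
    obtain ⟨v, m, hv, hm, hmv, hw⟩ := Nat.find_spec hex
    have hmin := fun k => Nat.find_min (H := hex) (m := k)
    have hle : Nat.find hex ≤ l0.length := Nat.find_min' hex
      ⟨l0, [j], rfl, by simp, by simp at hl ⊢; omega, rfl⟩
    have hvN : v.length < N := by rw [hv]; simp at hl; omega
    have hvred : ∀ l', wprod n d A l' = wprod n d A v → v.length ≤ l'.length := by
      intro l' e
      have := hred (m ++ l') (by rw [wprod_append, e, ← wprod_append, hw])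
      simp at this
      omega
    have hvs : ∀ c, (c = j ∨ c = i) → 0 ≤ wprod n d A v (sroot n c) := by
      intro c hc
      refine ih v.length hvN v rfl hvred c ?_
      intro l' e
      by_contra hlt
      have e2 : wprod n d A ((m ++ [c]) ++ l') = wprod n d A (j :: l0) := by
        rw [wprod_append, wprod_append, e, wprod_cons, wprod_cons, wprod_nil, one_mul,
          mul_assoc, ← mul_assoc (simpleRefl n d A c), simple_sq h, one_mul, ← wprod_append, hw]
      have := hred _ e2
      simp at this
      refine hmin l'.length (by omega) ⟨l', m ++ [c], rfl, ?_, ?_, e2⟩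
      · intro x hx
        rcases List.mem_append.1 hx with hx | hx
        · exact hm x hx
        · simp at hx; rw [hx]; exact hc
      · simp; omega
    have hd := dihedral h i j hij m hm (by
      intro m' e
      have := hred (m' ++ v) (by rw [wprod_append, e, ← wprod_append, hw])
      simp at this
      omega) (by
      intro m' e
      have := hi (m' ++ v) (by
        rw [wprod_append, e, wprod_cons, wprod_cons i, ← hw, wprod_append, mul_assoc])
      simp at this
      omega)
    obtain ⟨p, q, hp, hq, e⟩ := hd
    rw [← hw, wprod_append, Module.End.mul_apply, e, map_add, map_smul, map_smul]
    exact add_nonneg (smul_nonneg hp (hvs i (Or.inr rfl))) (smul_nonneg hq (hvs j (Or.inl rfl)))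

lemma exists_red (l : List (Fin n)) : ∃ l', wprod n d A l' = wprod n d A l ∧
    ∀ l'', wprod n d A l'' = wprod n d A l → l'.length ≤ l''.length := by
  classical
  have hex : ∃ k, ∃ l' : List (Fin n), l'.length = k ∧ wprod n d A l' = wprod n d A l :=
    ⟨_, l, rfl, rfl⟩
  obtain ⟨l', h1, h2⟩ := Nat.find_spec hex
  exact ⟨l', h2, fun l'' e => h1 ▸ Nat.find_min' hex ⟨l'', rfl, e⟩⟩

lemma pos_or_neg (h : Cart n d A) (l : List (Fin n)) (i : Fin n) :
    0 ≤ wprod n d A l (sroot n i) ∨ wprod n d A l (sroot n i) ≤ 0 := by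
  obtain ⟨l1, e1, m1⟩ := exists_red (d := d) (A := A) l
  obtain ⟨l2, e2, m2⟩ := exists_red (d := d) (A := A) (i :: l)
  rcases le_total l1.length l2.length with hle | hle
  · left
    rw [← e1]
    refine pos_main h _ l1 rfl (fun l' e => m1 l' (e.trans e1)) i (fun l' e => hle.trans
      (m2 l' (e.trans ?_)))
    rw [wprod_cons, e1, wprod_cons]
  · right
    have := pos_main h _ l2 rfl (fun l' e => m2 l' (e.trans e2)) i (fun l' e => hle.trans
      (m1 l' (e.trans ?_)))
    · rw [e2, wprod_cons_apply, simple_self h, map_neg] at this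
      exact neg_nonneg.1 this
    · rw [wprod_cons, e2, wprod_cons, mul_assoc, simple_sq h, mul_one]

lemma root_wprod {γ : Fin n → ℝ} (hγ : IsRoot n d A γ) (l : List (Fin n)) :
    IsRoot n d A (wprod n d A l γ) := by
  obtain ⟨m, i, rfl⟩ := hγ
  exact ⟨m ++ l, i, by rw [wprod_append]; rfl⟩

lemma root_neg (h : Cart n d A) {γ : Fin n → ℝ} (hγ : IsRoot n d A γ) : IsRoot n d A (-γ) := by
  obtain ⟨m, i, rfl⟩ := hγ
  exact ⟨i :: m, i, by rw [wprod_cons_apply, simple_self h, map_neg]⟩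

lemma root_pn (h : Cart n d A) {γ : Fin n → ℝ} (hγ : IsRoot n d A γ) : 0 ≤ γ ∨ γ ≤ 0 := by
  obtain ⟨m, i, rfl⟩ := hγ
  exact pos_or_neg h m i

lemma root_form (h : Cart n d A) {γ : Fin n → ℝ} (hγ : IsRoot n d A γ) :
    0 < formL n d A γ γ := by
  obtain ⟨m, i, rfl⟩ := hγ
  rw [form_wprod h, formL_sroot, h.hdiag]
  have : (0 : ℝ) < d i := by exact_mod_cast h.hd i
  push_cast
  linarith

lemma root_ne (h : Cart n d A) {γ : Fin n → ℝ} (hγ : IsRoot n d A γ) : γ ≠ 0 := by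
  rintro rfl
  have := root_form h hγ
  simp at this

/-- integer vectors -/
def IsI (x : Fin n → ℝ) : Prop := ∀ k, ∃ z : ℤ, x k = z

lemma sroot_I (i : Fin n) : IsI (sroot n i) := by
  intro k
  by_cases hk : k = i
  · exact ⟨1, by simp [sroot, hk]⟩
  · exact ⟨0, by simp [sroot, hk]⟩

lemma phi_I (h : Cart n d A) (i : Fin n) {x : Fin n → ℝ} (hx : IsI x) :
    ∃ z : ℤ, phi n d A i x = z := by
  choose z hz using hx
  have : x = ∑ j, x j • sroot n j := by
    ext k
    simp [sroot, Finset.sum_apply, Pi.single_apply]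
  rw [this, map_sum]
  refine ⟨∑ j, z j * A i j, ?_⟩
  push_cast
  refine Finset.sum_congr rfl fun j _ => ?_
  rw [map_smul, phi_sroot h, hz, smul_eq_mul]

lemma wprod_I (h : Cart n d A) (l : List (Fin n)) {x : Fin n → ℝ} (hx : IsI x) :
    IsI (wprod n d A l x) := by
  induction l generalizing x with
  | nil => exact hx
  | cons a l ih =>
    rw [wprod_cons_apply]
    apply ih
    rw [simple_apply]
    intro k
    obtain ⟨z, hz⟩ := phi_I h a hx
    obtain ⟨y, hy⟩ := hx k
    obtain ⟨u, hu⟩ := sroot_I a k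
    refine ⟨y - z * u, ?_⟩
    simp [hz, hy, hu]

lemma wprod_rev_apply (h : Cart n d A) (l : List (Fin n)) (x : Fin n → ℝ) :
    wprod n d A l.reverse (wprod n d A l x) = x := by
  rw [← Module.End.mul_apply, wprod_rev' h]; rfl

lemma wprod_rev_apply' (h : Cart n d A) (l : List (Fin n)) (x : Fin n → ℝ) :
    wprod n d A l (wprod n d A l.reverse x) = x := by
  rw [← Module.End.mul_apply, wprod_rev h]; rfl

lemma root_I (h : Cart n d A) {γ : Fin n → ℝ} (hγ : IsRoot n d A γ) : IsI γ := by
  obtain ⟨m, i, rfl⟩ := hγ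
  exact wprod_I h _ (sroot_I i)

lemma scal_I (h : Cart n d A) {γ β : Fin n → ℝ} (hγ : IsRoot n d A γ) (hβ : IsRoot n d A β)
    {c : ℝ} (e : γ = c • β) : ∃ z : ℤ, c = z := by
  obtain ⟨m, i, rfl⟩ := hβ
  have h1 := root_I h (root_wprod hγ m.reverse)
  rw [e, map_smul, wprod_rev_apply h] at h1
  simpa [sroot] using h1 i

lemma reduced (h : Cart n d A) {γ β : Fin n → ℝ} (hγ : IsRoot n d A γ) (hβ : IsRoot n d A β)
    {c : ℝ} (e : γ = c • β) : c = 1 ∨ c = -1 := by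
  have hc : c ≠ 0 := by
    rintro rfl
    exact root_ne h hγ (by simpa using e)
  obtain ⟨z, hz⟩ := scal_I h hγ hβ e
  obtain ⟨y, hy⟩ := scal_I h hβ hγ (c := c⁻¹) (by rw [e, smul_smul, inv_mul_cancel₀ hc, one_smul])
  have : z * y = 1 := by
    have : (z : ℝ) * y = 1 := by rw [← hz, ← hy, mul_inv_cancel₀ hc]
    exact_mod_cast this
  rcases Int.mul_eq_one_iff_eq_one_or_neg_one.1 this with h | h
  · left; rw [hz, h.1]; simp
  · right; rw [hz, h.1]; simp

lemma both_zero {x : Fin n → ℝ} (h1 : 0 ≤ x) (h2 : x ≤ 0) : x = 0 := le_antisymm h2 h1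

lemma reduced_pos (h : Cart n d A) {γ β : Fin n → ℝ} (hγ : IsPosRoot n d A γ)
    (hβ : IsPosRoot n d A β) {c : ℝ} (e : γ = c • β) : γ = β := by
  rcases reduced h hγ.1 hβ.1 e with rfl | rfl
  · simpa using e
  · exfalso
    apply root_ne h hγ.1
    apply both_zero hγ.2
    rw [e, neg_one_smul]
    exact neg_nonpos.2 hβ.2

/-- inversion set -/
def InvSet (n : ℕ) (d : Fin n → ℤ) (A : Fin n → Fin n → ℤ) (w : Module.End ℝ (Fin n → ℝ)) :
    Set (Fin n → ℝ) := {γ | IsPosRoot n d A γ ∧ w γ ≤ 0}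

lemma inv_simple (h : Cart n d A) (i : Fin n) {γ : Fin n → ℝ} (hγ : IsPosRoot n d A γ)
    (hn : simpleRefl n d A i γ ≤ 0) : γ = sroot n i := by
  refine reduced_pos h hγ ⟨⟨[], i, rfl⟩, ?_⟩ (c := γ i) ?_
  · have : 0 ≤ sroot n i := Pi.single_nonneg.2 zero_le_one
    exact this
  · ext k
    by_cases hk : k = i
    · subst hk; simp [sroot]
    · have := hn k
      rw [simple_apply] at this
      simp [sroot, hk] at this
      simp [sroot, hk]
      exact le_antisymm this (hγ.2 k)

lemma snoc_apply (l : List (Fin n)) (i : Fin n) (x : Fin n → ℝ) :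
    wprod n d A (l ++ [i]) x = simpleRefl n d A i (wprod n d A l x) := by
  rw [wprod_append, wprod_cons, wprod_nil, one_mul]; rfl

lemma inv_bound (h : Cart n d A) (l : List (Fin n)) :
    (InvSet n d A (wprod n d A l)).Finite ∧ (InvSet n d A (wprod n d A l)).ncard ≤ l.length := by
  induction l using List.reverseRecOn with
  | nil =>
    have : InvSet n d A (wprod n d A []) = ∅ := by
      ext γ
      simp only [InvSet, Set.mem_setOf_eq, Set.mem_empty_iff_false, iff_false]
      rintro ⟨h1, h2⟩
      exact root_ne h h1.1 (both_zero h1.2 h2)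
    rw [this]; simp
  | append_singleton l i ih =>
    have hsub : InvSet n d A (wprod n d A (l ++ [i])) ⊆
        insert (wprod n d A l.reverse (sroot n i)) (InvSet n d A (wprod n d A l)) := by
      rintro γ ⟨h1, h2⟩
      rcases root_pn h (root_wprod h1.1 l) with hp | hp
      · left
        rw [snoc_apply] at h2
        have := inv_simple h i ⟨root_wprod h1.1 l, hp⟩ h2
        rw [← this, wprod_rev_apply h]
      · right; exact ⟨h1, hp⟩
    refine ⟨(ih.1.insert _).subset hsub, ?_⟩
    refine (Set.ncard_le_ncard hsub (ih.1.insert _)).trans ((Set.ncard_insert_le _ _).trans ?_)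
    simpa using ih.2

lemma refl_apply (β x : Fin n → ℝ) :
    reflAlong n d A β x = x - (2 / formL n d A β β * formL n d A β x) • β := by
  simp [reflAlong, mul_smul]

lemma refl_eq (h : Cart n d A) {β : Fin n → ℝ} (hβ : IsRoot n d A β) :
    ∃ l, wprod n d A l = reflAlong n d A β := by
  obtain ⟨m, i, rfl⟩ := hβ
  refine ⟨m.reverse ++ [i] ++ m, ?_⟩
  refine LinearMap.ext fun x => ?_
  rw [wprod_append, Module.End.mul_apply, snoc_apply, simple_apply, map_sub, map_smul,
    wprod_rev_apply' h, refl_apply, form_wprod h, formL_sroot, h.hdiag]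
  congr 2
  have := d_ne h i
  rw [← form_wprod h m.reverse (wprod n d A m (sroot n i)), wprod_rev_apply h]
  simp only [phi, LinearMap.smul_apply, smul_eq_mul]
  push_cast
  field_simp

lemma len_spec (h : Cart n d A) {β : Fin n → ℝ} (hβ : IsRoot n d A β) :
    ∃ l, l.length = len n d A (reflAlong n d A β) ∧ wprod n d A l = reflAlong n d A β := by
  obtain ⟨l, hl⟩ := refl_eq h hβ
  exact Nat.sInf_mem (s := {r | ∃ l : List (Fin n), l.length = r ∧
    wprod n d A l = reflAlong n d A β}) ⟨l.length, l, rfl, hl⟩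

lemma refl_self (h : Cart n d A) {β : Fin n → ℝ} (hβ : IsRoot n d A β) :
    reflAlong n d A β β = -β := by
  have := (root_form h hβ).ne'
  rw [refl_apply, div_mul_cancel₀ _ this]
  module

lemma root_refl (h : Cart n d A) {β γ : Fin n → ℝ} (hβ : IsRoot n d A β)
    (hγ : IsRoot n d A γ) : IsRoot n d A (reflAlong n d A β γ) := by
  obtain ⟨l, hl⟩ := refl_eq h hβ
  rw [← hl]; exact root_wprod hγ l

lemma refl_refl (h : Cart n d A) {β : Fin n → ℝ} (hβ : IsRoot n d A β) (x : Fin n → ℝ) :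
    reflAlong n d A β (reflAlong n d A β x) = x := by
  conv_lhs => rw [refl_apply β x]
  rw [map_sub, map_smul, refl_self h hβ, refl_apply]
  module

lemma key (h : Cart n d A) (L : Submodule ℝ (Fin n → ℝ)) (hL : Module.finrank ℝ L = 2)
    (R : Set (Fin n → ℝ)) (hR : R = {γ | IsRoot n d A γ} ∩ (L : Set (Fin n → ℝ)))
    (hs : Submodule.span ℝ R = L) (β : Fin n → ℝ) (hβ : IsPosRoot n d A β) (hβR : β ∈ R)
    (hinv : ∀ γ ∈ R, IsPosRoot n d A γ → γ ≠ β → 0 ≤ reflAlong n d A β γ) :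
    IsFundamentalIn n d A R β := by
  have hRL : ∀ γ, γ ∈ R ↔ IsRoot n d A γ ∧ γ ∈ L := by intro γ; rw [hR]; rfl
  have hβL : β ∈ L := ((hRL β).1 hβR).2
  have hβ0 : β ≠ 0 := root_ne h hβ.1
  -- a root outside the line of β
  obtain ⟨δ, hδp, hδR, hδne, hδb⟩ : ∃ δ, IsPosRoot n d A δ ∧ δ ∈ R ∧ δ ≠ β ∧
      formL n d A β δ ≤ 0 := by
    obtain ⟨δ0, h0, h0'⟩ : ∃ δ0 ∈ R, ∀ c : ℝ, δ0 ≠ c • β := by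
      by_contra hcon
      push Not at hcon
      have hle : L ≤ Submodule.span ℝ {β} := by
        rw [← hs, Submodule.span_le]
        intro γ hγ
        obtain ⟨c, hc⟩ := hcon γ hγ
        exact Submodule.mem_span_singleton.2 ⟨c, hc.symm⟩
      have := Submodule.finrank_mono hle
      rw [hL, finrank_span_singleton hβ0] at this
      omega
    obtain ⟨δ1, h1, h1', h1p⟩ : ∃ δ1 ∈ R, (∀ c : ℝ, δ1 ≠ c • β) ∧ IsPosRoot n d A δ1 := by
      have hr := (hRL δ0).1 h0
      rcases root_pn h hr.1 with hp | hp
      · exact ⟨δ0, h0, h0', hr.1, hp⟩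
      · refine ⟨-δ0, (hRL _).2 ⟨root_neg h hr.1, L.neg_mem hr.2⟩, ?_, root_neg h hr.1,
          neg_nonneg.2 hp⟩
        intro c hc
        exact h0' (-c) (by rw [neg_smul, ← hc, neg_neg])
    have hr1 := (hRL δ1).1 h1
    have h1ne : δ1 ≠ β := by simpa using h1' 1
    rcases le_or_gt (formL n d A β δ1) 0 with hb | hb
    · exact ⟨δ1, h1p, h1, h1ne, hb⟩
    · have hrr := root_refl h hβ.1 hr1.1
      refine ⟨reflAlong n d A β δ1, ⟨hrr, hinv δ1 h1 h1p h1ne⟩, (hRL _).2 ⟨hrr, ?_⟩, ?_, ?_⟩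
      · rw [refl_apply]; exact L.sub_mem hr1.2 (L.smul_mem _ hβL)
      · intro e
        have := refl_refl h hβ.1 δ1
        rw [e, refl_self h hβ.1] at this
        exact h1' (-1) (by rw [← this]; simp)
      · rw [refl_apply, map_sub, map_smul, smul_eq_mul]
        have := (root_form h hβ.1).ne'
        field_simp
        linarith
  have hδL : δ ∈ L := ((hRL δ).1 hδR).2
  have hind : LinearIndependent ℝ ![β, δ] := by
    rw [LinearIndependent.pair_iff' hβ0]
    intro c hc
    exact hδne (reduced_pos h hδp hβ hc.symm)
  have hun := LinearIndependent.pair_iff.1 hind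
  have hspan : Submodule.span ℝ {β, δ} = L := by
    have hle : Submodule.span ℝ {β, δ} ≤ L := by
      rw [Submodule.span_le]
      rintro x (rfl | rfl)
      · exact hβL
      · exact hδL
    apply Submodule.eq_of_le_of_finrank_eq hle
    have := finrank_span_eq_card hind
    rw [hL]
    rw [Matrix.range_cons, Matrix.range_cons, Matrix.range_empty, Set.union_empty,
      Set.singleton_union] at this
    simpa using this
  have hcoord : ∀ γ ∈ L, ∃ c c' : ℝ, γ = c • β + c' • δ := by
    intro γ hγ
    rw [← hspan, Submodule.mem_span_pair] at hγ
    obtain ⟨c, c', e⟩ := hγ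
    exact ⟨c, c', e.symm⟩
  choose! c c' hc using hcoord
  -- the δ-coordinate is nonnegative
  have hc'0 : ∀ γ ∈ R, IsPosRoot n d A γ → 0 ≤ c' γ := by
    intro γ hγ hγp
    by_contra hlt
    push Not at hlt
    have e := hc γ ((hRL γ).1 hγ).2
    have hγne : γ ≠ β := by
      intro e2
      have := (hun (c γ - 1) (c' γ) (by
        have : γ - β = 0 := by rw [e2, sub_self]
        rw [← this]; nth_rewrite 3 [e]; module)).2
      linarith
    have hcp : 0 < c γ := by
      by_contra hcn
      push Not at hcn
      apply root_ne h hγp.1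
      apply both_zero hγp.2
      rw [e]
      exact add_nonpos (smul_nonpos_of_nonpos_of_nonneg hcn hβ.2)
        (smul_nonpos_of_nonpos_of_nonneg hlt.le hδp.2)
    have p1 := hinv γ hγ hγp hγne
    have p2 := hinv δ hδR hδp hδne
    have e3 : reflAlong n d A β γ = -(c γ • β) + c' γ • reflAlong n d A β δ := by
      conv_lhs => rw [e]
      rw [map_add, map_smul, map_smul, refl_self h hβ.1, smul_neg]
    have h4 : c γ • β ≤ 0 := by
      have h5 : c γ • β = c' γ • reflAlong n d A β δ - reflAlong n d A β γ := by rw [e3]; abel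
      rw [h5]
      exact sub_nonpos.2 ((smul_nonpos_of_nonpos_of_nonneg hlt.le p2).trans p1)
    have h6 := both_zero (smul_nonneg hcp.le hβ.2) h4
    rcases smul_eq_zero.1 h6 with h7 | h7
    · linarith
    · exact hβ0 h7
  have hc'1 : ∀ γ ∈ R, IsPosRoot n d A γ → c γ < 0 → 0 < c' γ := by
    intro γ hγ hγp hneg
    rcases (hc'0 γ hγ hγp).lt_or_eq with hlt | heq
    · exact hlt
    · exfalso
      apply root_ne h hγp.1
      apply both_zero hγp.2
      rw [hc γ ((hRL γ).1 hγ).2, ← heq, zero_smul, add_zero]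
      exact smul_nonpos_of_nonpos_of_nonneg hneg.le hβ.2
  -- finiteness
  let S : Set (Fin n → ℝ) := {γ | γ ∈ R ∧ IsPosRoot n d A γ ∧ c γ < 0}
  have hSfin : S.Finite := by
    obtain ⟨l, hl⟩ := refl_eq h hδp.1
    refine (inv_bound h l).1.subset ?_
    rintro γ ⟨hγ, hγp, hneg⟩
    refine ⟨hγp, ?_⟩
    rw [hl]
    have e := hc γ ((hRL γ).1 hγ).2
    have hf := root_form h hδp.1
    have e2 : reflAlong n d A δ γ = c γ • β +
        (-(c' γ) - c γ * (2 / formL n d A δ δ * formL n d A δ β)) • δ := by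
      conv_lhs => rw [e]
      rw [map_add, map_smul, map_smul, refl_self h hδp.1, refl_apply]
      module
    rw [e2]
    refine add_nonpos (smul_nonpos_of_nonpos_of_nonneg hneg.le hβ.2)
        (smul_nonpos_of_nonpos_of_nonneg ?_ hδp.2)
    rw [formL_symm h δ β]
    have h1 : 2 / formL n d A δ δ * formL n d A β δ ≤ 0 :=
      mul_nonpos_of_nonneg_of_nonpos (by positivity) hδb
    have h2 := mul_nonneg_of_nonpos_of_nonpos hneg.le h1
    have h3 := hc'0 γ hγ hγp
    linarith
  have hcδ : c δ = 0 ∧ c' δ = 1 := by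
    have e := hc δ hδL
    have := hun (c δ) (c' δ - 1) (by
      have : δ - δ = 0 := sub_self δ
      rw [← this]; nth_rewrite 4 [e]; module)
    exact ⟨this.1, by linarith [this.2]⟩
  obtain ⟨β', hβ'S, hmin⟩ := Set.exists_min_image (insert δ S) (fun γ => c γ / c' γ)
    (hSfin.insert δ) ⟨δ, Set.mem_insert _ _⟩
  have hβ' : β' ∈ R ∧ IsPosRoot n d A β' ∧ 0 < c' β' := by
    rcases hβ'S with rfl | hS
    · exact ⟨hδR, hδp, by rw [hcδ.2]; norm_num⟩
    · exact ⟨hS.1, hS.2.1, hc'1 _ hS.1 hS.2.1 hS.2.2⟩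
  have hβ'e := hc β' ((hRL β').1 hβ'.1).2
  have hr0 : c β' / c' β' ≤ 0 := by
    have := hmin δ (Set.mem_insert _ _)
    simpa [hcδ.1] using this
  refine ⟨hβR, hβ, β', hβ'.1, hβ'.2.1, ?_, ?_⟩
  · intro e
    have := (hun (c β' - 1) (c' β') (by
        have : β' - β = 0 := by rw [e, sub_self]
        rw [← this]; nth_rewrite 3 [hβ'e]; module)).2
    linarith [hβ'.2.2]
  · intro γ hγ hγp
    have e := hc γ ((hRL γ).1 hγ).2
    have hp := hc'0 γ hγ hγp
    refine ⟨c γ - c' γ * (c β' / c' β'), c' γ / c' β', ?_, div_nonneg hp hβ'.2.2.le, ?_⟩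
    · rcases lt_or_ge (c γ) 0 with hneg | hnn
      · have h1 := hmin γ (Set.mem_insert_of_mem _ ⟨hγ, hγp, hneg⟩)
        have h2 := hc'1 γ hγ hγp hneg
        rw [le_div_iff₀ h2] at h1
        linarith
      · have := mul_nonpos_of_nonneg_of_nonpos hp hr0
        linarith
    · have := hβ'.2.2.ne'
      calc γ = c γ • β + c' γ • δ := e
        _ = (c γ - c' γ * (c β' / c' β')) • β +
            (c' γ / c' β') • (c β' • β + c' β' • δ) := by
          rw [smul_add, smul_smul, smul_smul, div_mul_cancel₀ _ this, ← add_assoc, ← add_smul]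
          congr 2
          ring
        _ = _ := by rw [← hβ'e]

lemma rank_two_unique (h : Cart n d A) {R R' : Set (Fin n → ℝ)} (hR : IsRankTwo n d A R)
    (hR' : IsRankTwo n d A R') {β γ : Fin n → ℝ} (hβ : IsPosRoot n d A β)
    (hγ : IsPosRoot n d A γ) (hne : γ ≠ β) (h1 : β ∈ R) (h2 : β ∈ R') (h3 : γ ∈ R)
    (h4 : γ ∈ R') : R = R' := by
  have hind : LinearIndependent ℝ ![β, γ] := by
    rw [LinearIndependent.pair_iff' (root_ne h hβ.1)]
    intro c hc
    exact hne (reduced_pos h hγ hβ hc.symm)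
  have aux : ∀ L : Submodule ℝ (Fin n → ℝ), Module.finrank ℝ L = 2 → β ∈ L → γ ∈ L →
      Submodule.span ℝ {β, γ} = L := by
    intro L hL hb hg
    have hle : Submodule.span ℝ {β, γ} ≤ L := by
      rw [Submodule.span_le]
      rintro x (rfl | rfl)
      · exact hb
      · exact hg
    apply Submodule.eq_of_le_of_finrank_eq hle
    have := finrank_span_eq_card hind
    rw [hL]
    rw [Matrix.range_cons, Matrix.range_cons, Matrix.range_empty, Set.union_empty,
      Set.singleton_union] at this
    simpa using this
  obtain ⟨L, hL, e, -⟩ := hR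
  obtain ⟨L', hL', e', -⟩ := hR'
  have i1 := aux L hL (by rw [e] at h1; exact h1.2) (by rw [e] at h3; exact h3.2)
  have i2 := aux L' hL' (by rw [e'] at h2; exact h2.2) (by rw [e'] at h4; exact h4.2)
  rw [e, e', ← i1, ← i2]

lemma cut_inv (h : Cart n d A) {R : Set (Fin n → ℝ)} {β : Fin n → ℝ} (hβ : IsPosRoot n d A β)
    (hR : CutsPerp n d A R β) :
    ∃ γ ∈ R, γ ∈ InvSet n d A (reflAlong n d A β) ∧ γ ≠ β := by
  obtain ⟨⟨L, hL, e, hs⟩, hβR, hnf⟩ := hR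
  by_contra hcon
  push Not at hcon
  apply hnf
  refine key h L hL R e hs β hβ hβR ?_
  intro γ hγ hγp hne
  have hr := root_refl h hβ.1 hγp.1
  rcases root_pn h hr with hp | hp
  · exact hp
  · exact absurd (hcon γ hγ ⟨hγp, hp⟩) hne

lemma final (h : Cart n d A) (β : Fin n → ℝ) (hβ : IsPosRoot n d A β) :
    {R | CutsPerp n d A R β}.Finite ∧
      Nat.card {R | CutsPerp n d A R β} ≤ (len n d A (reflAlong n d A β) - 1) / 2 := by
  obtain ⟨l, hl, hw⟩ := len_spec h hβ.1
  obtain ⟨hfin, hcard⟩ := inv_bound h l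
  rw [hw, hl] at hcard
  rw [hw] at hfin
  set C := {R | CutsPerp n d A R β} with hC
  have hex : ∀ R ∈ C, ∃ γ ∈ R, γ ∈ InvSet n d A (reflAlong n d A β) ∧ γ ≠ β :=
    fun R hR => cut_inv h hβ hR
  choose! f hfR hfI hfne using hex
  let g : Set (Fin n → ℝ) → (Fin n → ℝ) := fun R => - reflAlong n d A β (f R)
  have hg1 : ∀ R ∈ C, IsPosRoot n d A (g R) := fun R hR =>
    ⟨root_neg h (root_refl h hβ.1 (hfI R hR).1.1), neg_nonneg.2 (hfI R hR).2⟩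
  have hgrefl : ∀ R, reflAlong n d A β (g R) = - f R := by
    intro R
    simp only [g, map_neg, refl_refl h hβ.1]
  have hgI : ∀ R ∈ C, g R ∈ InvSet n d A (reflAlong n d A β) := by
    intro R hR
    refine ⟨hg1 R hR, ?_⟩
    rw [hgrefl]
    exact neg_nonpos.2 (hfI R hR).1.2
  have hgne : ∀ R ∈ C, g R ≠ β := by
    intro R hR e
    have := hgrefl R
    rw [e, refl_self h hβ.1] at this
    exact hfne R hR (neg_injective this).symm
  have hgR : ∀ R ∈ C, g R ∈ R := by
    intro R hR
    have h1 := hfR R hR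
    have h2 := hR.2.1
    obtain ⟨L, -, e, -⟩ := hR.1
    have hr := (hg1 R hR).1
    have hm : ∀ x, x ∈ R ↔ IsRoot n d A x ∧ x ∈ L := by intro x; rw [e]; rfl
    refine (hm _).2 ⟨hr, ?_⟩
    simp only [g, refl_apply]
    exact L.neg_mem (L.sub_mem ((hm _).1 h1).2 (L.smul_mem _ ((hm _).1 h2).2))
  have huniq : ∀ R ∈ C, ∀ R' ∈ C, ∀ γ, IsPosRoot n d A γ → γ ≠ β → γ ∈ R → γ ∈ R' → R = R' :=
    fun R hR R' hR' γ hγ hne h3 h4 =>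
      rank_two_unique h hR.1 hR'.1 hβ hγ hne hR.2.1 hR'.2.1 h3 h4
  have hfinj : Set.InjOn f C := by
    intro R hR R' hR' e
    exact huniq R hR R' hR' (f R) (hfI R hR).1 (hfne R hR) (hfR R hR) (e ▸ hfR R' hR')
  have hginj : Set.InjOn g C := by
    intro R hR R' hR' e
    exact huniq R hR R' hR' (g R) (hg1 R hR) (hgne R hR) (hgR R hR) (e ▸ hgR R' hR')
  have hfimg : f '' C ⊆ InvSet n d A (reflAlong n d A β) := by
    rintro _ ⟨R, hR, rfl⟩; exact hfI R hR
  have hgimg : g '' C ⊆ InvSet n d A (reflAlong n d A β) := by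
    rintro _ ⟨R, hR, rfl⟩; exact hgI R hR
  have hβI : β ∈ InvSet n d A (reflAlong n d A β) :=
    ⟨hβ, by rw [refl_self h hβ.1]; exact neg_nonpos.2 hβ.2⟩
  have hCfin : C.Finite := Set.Finite.of_finite_image (hfin.subset hfimg) hfinj
  have hdisj : Disjoint (f '' C) (g '' C) := by
    rw [Set.disjoint_left]
    rintro _ ⟨R, hR, rfl⟩ ⟨R', hR', e⟩
    have hRR : R' = R := huniq R' hR' R hR (f R) (hfI R hR).1 (hfne R hR) (e ▸ hgR R' hR')
      (hfR R hR)
    subst hRR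
    simp only [g, refl_apply] at e
    apply hfne R' hR'
    refine reduced_pos h (hfI R' hR').1 hβ
      (c := (2 / formL n d A β β * formL n d A β (f R')) / 2) ?_
    have e2 : (2 : ℝ) • f R' = (2 / formL n d A β β * formL n d A β (f R')) • β := by
      rw [two_smul]
      nth_rewrite 1 [← e]
      abel
    rw [div_eq_inv_mul, mul_smul, ← e2, smul_smul]
    norm_num
  have hnot : β ∉ f '' C ∪ g '' C := by
    rintro (⟨R, hR, e⟩ | ⟨R, hR, e⟩)
    · exact hfne R hR e
    · exact hgne R hR e
  have hfi := hCfin.image f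
  have hgi := hCfin.image g
  have hle := Set.ncard_le_ncard (Set.insert_subset hβI (Set.union_subset hfimg hgimg)) hfin
  rw [Set.ncard_insert_of_notMem hnot (hfi.union hgi), Set.ncard_union_eq hdisj hfi hgi,
    Set.ncard_image_of_injOn hfinj, Set.ncard_image_of_injOn hginj] at hle
  refine ⟨hCfin, ?_⟩
  rw [Nat.card_coe_set_eq]
  omega

end aux

/-- for a positive root `β`, the collection of rank two subsystems
cutting `β^⊥` is finite, of cardinality at most `(ℓ(t_β) - 1)/2`. -/
theorem stmt7 (n : ℕ) (hn : 1 ≤ n) (d : Fin n → ℤ) (A : Fin n → Fin n → ℤ)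
    (hd : ∀ i, 0 < d i) (hdiag : ∀ i, A i i = 2)
    (hoff : ∀ i j, i ≠ j → A i j ≤ 0)
    (hsym : ∀ i j, d i * A i j = d j * A j i)
    (β : Fin n → ℝ) (hβ : IsPosRoot n d A β) :
    {R | CutsPerp n d A R β}.Finite ∧
      Nat.card {R | CutsPerp n d A R β} ≤ (len n d A (reflAlong n d A β) - 1) / 2 := by
  exact final ⟨hd, hdiag, hoff, hsym⟩ β hβ

end
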